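/- arXiv:2603.29556 — 2 statements merged into one kernel-verified Lean document; each statement's English description precedes it below -/
import Mathlib

section
/- If a linear map φ : A → B between C*-algebras is positive and either A or B is commutative, then φ is completely positive. -/
open Matrix

/-- Positivity of an element of `M_k(B)` for a star ring `B`: `M ≥ 0` iff `M = bᴴ * b`.
For `k = 1` this recovers the positive elements of `B` itself. -/
def PosIn {k : ℕ} {B : Type*} [Ring B] [StarRing B]
    (M : Matrix (Fin k) (Fin k) B) : Prop :=
  ∃ b : Matrix (Fin k) (Fin k) B, M = b.conjTranspose * b

section CStarAlgebra

variable {B : Type*} [CStarAlgebra B] [PartialOrder B] [StarOrderedRing B] {k : ℕ}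

theorem CStarAlgebra.nonneg_iff_exists_eq_star_mul_self {b : B} :
    0 ≤ b ↔ ∃ c : B, b = star c * c :=
  CStarAlgebra.nonneg_iff_eq_star_mul_self

theorem posIn_iff_nonneg {M : Matrix (Fin k) (Fin k) B} :
    PosIn M ↔ 0 ≤ CStarMatrix.ofMatrix M :=
  (CStarAlgebra.nonneg_iff_exists_eq_star_mul_self (B := CStarMatrix (Fin k) (Fin k) B)).symm

theorem PosIn.sum {ι : Type*} {s : Finset ι} {M : ι → Matrix (Fin k) (Fin k) B}
    (hM : ∀ i ∈ s, PosIn (M i)) : PosIn (∑ i ∈ s, M i) := by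
  rw [posIn_iff_nonneg]
  have h : CStarMatrix.ofMatrix (∑ i ∈ s, M i) = ∑ i ∈ s, CStarMatrix.ofMatrix (M i) :=
    map_sum (CStarMatrix.ofMatrixₗ (R := ℂ)) M s
  rw [h]
  exact Finset.sum_nonneg fun i hi => posIn_iff_nonneg.mp (hM i hi)

theorem isClosed_posIn : IsClosed {M : Matrix (Fin k) (Fin k) B | PosIn M} := by
  simp only [posIn_iff_nonneg]
  exact CStarAlgebra.isClosed_nonneg.preimage
    (CStarMatrix.uniformEmbedding_ofMatrix (m := Fin k) (n := Fin k) (A := B)).uniformContinuous.continuous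

theorem nonneg_of_forall_isUnit_algebraMap_sub {b : B} (hb : IsSelfAdjoint b)
    (h : ∀ r : ℝ, r < 0 → IsUnit (algebraMap ℂ B r - b)) : 0 ≤ b := by
  rw [StarOrderedRing.nonneg_iff_spectrum_nonneg (R := ℝ) b hb]
  intro r hr
  by_contra! hr0
  refine hr ?_
  rw [spectrum.mem_resolventSet_iff, IsScalarTower.algebraMap_apply ℝ ℂ B]
  exact h r hr0

theorem map_star_of_nonneg {A : Type*} [CStarAlgebra A] [PartialOrder A] [StarOrderedRing A]
    {φ : A →ₗ[ℂ] B} (hφ : ∀ a, 0 ≤ a → 0 ≤ φ a) (a : A) : φ (star a) = star (φ a) := by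
  obtain ⟨y, hy, -, rfl⟩ := CStarAlgebra.exists_sum_four_nonneg a
  simp only [star_sum, star_smul, map_sum, map_smul]
  refine Finset.sum_congr rfl fun i _ => ?_
  rw [(IsSelfAdjoint.of_nonneg (hy i)).star_eq, (IsSelfAdjoint.of_nonneg (hφ _ (hy i))).star_eq]

end CStarAlgebra

section CommutativeCodomain

open WeakDual
open scoped ComplexOrder

variable {B : Type*} [CommCStarAlgebra B]

theorem isUnit_of_forall_characterSpace {b : B} (h : ∀ χ : characterSpace ℂ B, χ b ≠ 0) :
    IsUnit b := by
  by_contra hb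
  obtain ⟨χ, hχ⟩ := CharacterSpace.exists_apply_eq_zero hb
  exact h χ hχ

variable [PartialOrder B] [StarOrderedRing B] {k : ℕ}

/-- A matrix over a commutative C⋆-algebra is positive if it is so at every character. -/
theorem posIn_of_forall_characterSpace {M : Matrix (Fin k) (Fin k) B}
    (h : ∀ χ : characterSpace ℂ B, (M.map χ).PosSemidef) : PosIn M := by
  have hsa : IsSelfAdjoint (CStarMatrix.ofMatrix M) := by
    refine CStarMatrix.ext fun i j => (gelfandTransform_isometry B).injective ?_
    ext χ
    have := congr_fun₂ (h χ).isHermitian i j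
    simpa [CStarMatrix.star_apply, map_star] using this
  rw [posIn_iff_nonneg]
  refine nonneg_of_forall_isUnit_algebraMap_sub hsa fun r hr => ?_
  suffices H : IsUnit (algebraMap ℂ (Matrix (Fin k) (Fin k) B) r - M) from
    H.map CStarMatrix.ofMatrixRingEquiv
  rw [Matrix.isUnit_iff_isUnit_det]
  refine isUnit_of_forall_characterSpace fun χ => ?_
  have hpd : (M.map χ + (-r) • (1 : Matrix (Fin k) (Fin k) ℂ)).PosDef :=
    Matrix.PosDef.posSemidef_add (h χ) (Matrix.PosDef.one.smul (neg_pos.mpr hr))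
  have hmat : (RingHomClass.toRingHom χ).mapMatrix (algebraMap ℂ (Matrix (Fin k) (Fin k) B) r - M)
      = -(M.map χ + (-r) • (1 : Matrix (Fin k) (Fin k) ℂ)) := by
    ext i j
    by_cases hij : i = j <;>
      simp [Matrix.algebraMap_matrix_apply, hij, AlgHomClass.commutes, sub_eq_add_neg]
  have hdet := (Matrix.isUnit_iff_isUnit_det _).mp hpd.isUnit.neg
  rw [← hmat, ← RingHom.map_det] at hdet
  exact hdet.ne_zero

theorem PosIn.map_of_commutative_codomain {A : Type*} [CStarAlgebra A] [PartialOrder A]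
    [StarOrderedRing A] {φ : A →ₗ[ℂ] B} (hφ : ∀ a, 0 ≤ a → 0 ≤ φ a)
    {M : Matrix (Fin k) (Fin k) A} (hM : PosIn M) : PosIn (M.map φ) := by
  obtain ⟨b, rfl⟩ := hM
  refine posIn_of_forall_characterSpace fun χ => .of_dotProduct_mulVec_nonneg ?_ fun x => ?_
  · ext i j
    simp only [conjTranspose_apply, map_apply, ← map_star χ, ← map_star_of_nonneg hφ]
    rw [← conjTranspose_apply, conjTranspose_mul, conjTranspose_conjTranspose]
  · have key : star x ⬝ᵥ ((bᴴ * b).map φ).map χ *ᵥ x =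
        χ (φ (∑ l, star (∑ i, x i • b l i) * ∑ j, x j • b l j)) := by
      simp only [dotProduct, mulVec, Finset.mul_sum, star_sum, Finset.sum_mul, map_sum,
        map_apply, mul_apply, conjTranspose_apply, star_smul, smul_mul_smul_comm, map_smul,
        Pi.star_apply, smul_eq_mul]
      rw [Finset.sum_comm]
      conv_rhs => rw [Finset.sum_comm]
      refine Finset.sum_congr rfl fun j _ => ?_
      rw [Finset.sum_comm]
      exact Finset.sum_congr rfl fun l _ => Finset.sum_congr rfl fun i _ => by ring
    rw [key]
    have := hφ _ (Finset.sum_nonneg fun l (_ : l ∈ Finset.univ) =>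
      star_mul_self_nonneg (∑ i, x i • b l i))
    obtain ⟨z, hz⟩ := CStarAlgebra.nonneg_iff_eq_star_mul_self.mp this
    rw [hz, map_mul, map_star]
    exact star_mul_self_nonneg _

end CommutativeCodomain

section CommutativeDomain

open WeakDual Filter Topology

/-- A continuous function on a compact Hausdorff space with values in a real normed space is a
uniform limit of finite combinations of its values with nonnegative continuous coefficients. -/
theorem exists_forall_norm_sub_sum_smul_le {X E : Type*} [TopologicalSpace X] [CompactSpace X]
    [T2Space X] [NormedAddCommGroup E] [NormedSpace ℝ E] {g : X → E} (hg : Continuous g)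
    {ε : ℝ} (hε : 0 < ε) :
    ∃ (s : Finset X) (f : X → C(X, ℝ)), (∀ x t, 0 ≤ f x t) ∧
      ∀ t, ‖g t - ∑ x ∈ s, f x t • g x‖ ≤ ε := by
  obtain ⟨p, hp⟩ := PartitionOfUnity.exists_isSubordinate (s := Set.univ) isClosed_univ
    (fun x => g ⁻¹' Metric.ball (g x) ε) (fun x => Metric.isOpen_ball.preimage hg)
    (fun x _ => Set.mem_iUnion.mpr ⟨x, Metric.mem_ball_self hε⟩)
  have hfin := p.locallyFinite.finite_nonempty_of_compact
  refine ⟨hfin.toFinset, p, fun x t => p.nonneg x t, fun t => ?_⟩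
  have hmem : ∑ᶠ x, p x t • g x ∈ Metric.closedBall (g t) ε := by
    refine p.finsum_smul_mem_convex (g := fun x _ => g x) (Set.mem_univ t) (fun x hx => ?_)
      (convex_closedBall _ _)
    have : t ∈ g ⁻¹' Metric.ball (g x) ε := hp x (subset_tsupport _ hx)
    rw [Metric.mem_closedBall, dist_comm]
    exact (Metric.mem_ball.mp this).le
  rw [finsum_eq_sum_of_support_subset (s := hfin.toFinset), Metric.mem_closedBall, dist_comm,
    dist_eq_norm] at hmem
  · exact hmem
  · intro x hx
    have : p x t ≠ 0 := fun h => hx (by simp [h])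
    rw [Finset.mem_coe, Set.Finite.mem_toFinset]
    exact ⟨t, this⟩

theorem PosIn.of_smul {B : Type*} [CStarAlgebra B] [PartialOrder B] [StarOrderedRing B] {k : ℕ}
    {C : Matrix (Fin k) (Fin k) ℂ} (hC : PosIn C) {b : B} (hb : 0 ≤ b) :
    PosIn (C.map fun c => c • b) := by
  obtain ⟨D, rfl⟩ := hC
  obtain ⟨z, rfl⟩ := CStarAlgebra.nonneg_iff_eq_star_mul_self.mp hb
  refine ⟨D.map fun d => d • z, ?_⟩
  ext i j
  simp [mul_apply, Finset.sum_smul, smul_smul, mul_comm]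

theorem PosIn.map_ringHom {R S : Type*} [Ring R] [StarRing R] [Ring S] [StarRing S] {k : ℕ}
    {M : Matrix (Fin k) (Fin k) R} (hM : PosIn M) (χ : R →+* S)
    (hχ : ∀ r, χ (star r) = star (χ r)) : PosIn (M.map χ) := by
  obtain ⟨b, rfl⟩ := hM
  refine ⟨b.map χ, ?_⟩
  ext i j
  simp [mul_apply, hχ]

variable {A B : Type*} [CommCStarAlgebra A] [PartialOrder A] [StarOrderedRing A]
  [CStarAlgebra B] [PartialOrder B] [StarOrderedRing B] {k : ℕ}

/-- A matrix over a commutative C⋆-algebra is approximated by finite sums of its values at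
characters, multiplied by positive elements. -/
theorem exists_forall_norm_sub_sum_characterSpace_smul_le (M : Matrix (Fin k) (Fin k) A)
    {ε : ℝ} (hε : 0 < ε) :
    ∃ (s : Finset (characterSpace ℂ A)) (a : characterSpace ℂ A → A), (∀ χ, 0 ≤ a χ) ∧
      ∀ i j, ‖M i j - ∑ χ ∈ s, χ (M i j) • a χ‖ ≤ ε := by
  obtain ⟨s, f, hf, hfM⟩ := exists_forall_norm_sub_sum_smul_le
    (g := fun (χ : characterSpace ℂ A) (i j : Fin k) => χ (M i j))
    (continuous_pi fun i => continuous_pi fun j => (gelfandTransform ℂ A (M i j)).continuous) hε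
  let c : characterSpace ℂ A → C(characterSpace ℂ A, ℂ) := fun χ =>
    ⟨fun t => (√(f χ t) : ℂ), by fun_prop⟩
  refine ⟨s, fun χ => star ((gelfandStarTransform A).symm (c χ)) *
    (gelfandStarTransform A).symm (c χ), fun χ => star_mul_self_nonneg _, fun i j => ?_⟩
  rw [← (gelfandTransform_isometry A).norm_map_of_map_zero (map_zero _),
    ContinuousMap.norm_le _ hε.le]
  intro t
  have hc : ∀ χ : characterSpace ℂ A, t ((gelfandStarTransform A).symm (c χ)) = √(f χ t) :=
    fun χ => congr_arg (· t) ((gelfandStarTransform A).apply_symm_apply (c χ))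
  have hsq : ∀ χ : characterSpace ℂ A, (√(f χ t) : ℂ) * √(f χ t) = f χ t := fun χ => by
    rw [← Complex.ofReal_mul, Real.mul_self_sqrt (hf χ t)]
  have hval : t (M i j - ∑ χ ∈ s, χ (M i j) • (star ((gelfandStarTransform A).symm (c χ)) *
      (gelfandStarTransform A).symm (c χ))) = t (M i j) - ∑ χ ∈ s, f χ t • χ (M i j) := by
    rw [map_sub, map_sum]
    congr 1
    refine Finset.sum_congr rfl fun χ _ => ?_
    rw [map_smul, map_mul, map_star, hc, Complex.star_def, Complex.conj_ofReal, hsq, smul_eq_mul,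
      mul_comm, Complex.real_smul]
  have hbound : ‖t (M i j) - ∑ χ ∈ s, f χ t • χ (M i j)‖ ≤ ε := by
    have h := hfM t
    rw [pi_norm_le_iff_of_nonneg hε.le] at h
    have h := h i
    rw [pi_norm_le_iff_of_nonneg hε.le] at h
    simpa only [Pi.sub_apply, Finset.sum_apply, Pi.smul_apply] using h j
  exact hval.symm ▸ hbound

theorem PosIn.map_of_commutative_domain {φ : A →ₗ[ℂ] B} (hφ : ∀ a, 0 ≤ a → 0 ≤ φ a)
    {M : Matrix (Fin k) (Fin k) A} (hM : PosIn M) : PosIn (M.map φ) := by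
  have hcont : Continuous φ := map_continuous (PositiveLinearMap.mk₀ φ hφ)
  have hclosed : IsClosed {N : Matrix (Fin k) (Fin k) A | PosIn (N.map φ)} :=
    isClosed_posIn.preimage (continuous_id.matrix_map hcont)
  choose s a ha hsa using fun n : ℕ =>
    exists_forall_norm_sub_sum_characterSpace_smul_le M (Nat.one_div_pos_of_nat (α := ℝ) (n := n))
  have hlim : Tendsto (fun n => ∑ χ ∈ s n, (M.map χ).map fun c => c • a n χ) atTop (𝓝 M) := by
    refine tendsto_pi_nhds.mpr fun i => tendsto_pi_nhds.mpr fun j => ?_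
    rw [tendsto_iff_norm_sub_tendsto_zero]
    refine squeeze_zero (fun _ => norm_nonneg _) (fun n => ?_)
      (tendsto_one_div_add_atTop_nhds_zero_nat (𝕜 := ℝ))
    rw [norm_sub_rev]
    simpa [Matrix.sum_apply] using hsa n i j
  refine hclosed.mem_of_tendsto hlim (Eventually.of_forall fun n => ?_)
  have hmap : (∑ χ ∈ s n, (M.map χ).map fun c => c • a n χ).map φ =
      ∑ χ ∈ s n, (M.map χ).map fun c => c • φ (a n χ) := by
    ext i j
    simp [Matrix.sum_apply]
  rw [Set.mem_ofPred_eq, hmap]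
  exact PosIn.sum fun χ _ =>
    (hM.map_ringHom (RingHomClass.toRingHom χ) (map_star χ)).of_smul (hφ _ (ha n χ))

end CommutativeDomain

/-- a positive linear map `φ : A → B` between C*-algebras, with `A` or `B`
commutative, is completely positive (all amplifications `M_k(A) → M_k(B)` are positive). -/
theorem stmt3 {A B : Type*}
    [NormedRing A] [StarRing A] [CStarRing A] [NormedAlgebra ℂ A] [StarModule ℂ A]
    [CompleteSpace A]
    [NormedRing B] [StarRing B] [CStarRing B] [NormedAlgebra ℂ B] [StarModule ℂ B]
    [CompleteSpace B]
    (φ : A →ₗ[ℂ] B)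
    (hpos : ∀ a : A, (∃ y : A, a = star y * y) → ∃ z : B, φ a = star z * z)
    (hcomm : (∀ x y : A, x * y = y * x) ∨ (∀ x y : B, x * y = y * x)) :
    ∀ (k : ℕ) (M : Matrix (Fin k) (Fin k) A), PosIn M → PosIn (M.map φ) := by
  let : CStarAlgebra A := {}
  let : CStarAlgebra B := {}
  let := CStarAlgebra.spectralOrder A
  let := CStarAlgebra.spectralOrder B
  have := CStarAlgebra.spectralOrderedRing A
  have := CStarAlgebra.spectralOrderedRing B
  have hφ : ∀ a : A, 0 ≤ a → 0 ≤ φ a := fun a ha =>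
    CStarAlgebra.nonneg_iff_eq_star_mul_self.mpr
      (hpos a (CStarAlgebra.nonneg_iff_eq_star_mul_self.mp ha))
  intro k M hM
  rcases hcomm with h | h
  · let : CommCStarAlgebra A := { mul_comm := h }
    exact hM.map_of_commutative_domain hφ
  · let : CommCStarAlgebra B := { mul_comm := h }
    exact hM.map_of_commutative_codomain hφ
end

section
/- For a linear map φ : N → M_d(ℂ) from a C*-algebra N, define the functional φ̂ on M_d(ℂ) ⊗ N by φ̂(∑_i a_i ⊗ b_i) := Tr(∑_i a_iᵀ φ(b_i)). Then φ̂ is nonnegative on all separable elements of M_d ⊗ N if and only if φ is a positive map. -/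
open Matrix ComplexOrder

variable {N : Type*} [NormedRing N] [StarRing N] [CStarRing N] [NormedAlgebra ℂ N]
  [StarModule ℂ N] [CompleteSpace N]

/-- The separable elements of `M_d(ℂ) ⊗ N ≅ M_d(N)`: the closed cone generated by the
elementary tensors `P ⊗ Q` with `P ∈ M_d(ℂ)` positive semidefinite and `Q ∈ N` positive. -/
def SepN (d : ℕ) : Set (Matrix (Fin d) (Fin d) N) :=
  closure {X | ∃ (L : ℕ) (P : Fin L → Matrix (Fin d) (Fin d) ℂ) (Q : Fin L → N),
    (∀ t, (P t).PosSemidef) ∧ (∀ t, ∃ y : N, Q t = star y * y) ∧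
    X = ∑ t, fun i j => P t i j • Q t}

/-- A complex matrix whose quadratic form is nonnegative is positive semidefinite: being Hermitian
is automatic over `ℂ`. -/
theorem posSemidef_of_forall_dotProduct_mulVec_nonneg {n : Type*} [Fintype n]
    {A : Matrix n n ℂ} (h : ∀ x : n → ℂ, 0 ≤ star x ⬝ᵥ (A *ᵥ x)) : A.PosSemidef := by
  classical
  rw [← isPositive_toEuclideanLin_iff, LinearMap.isPositive_iff_complex]
  intro x
  have hx : 0 ≤ inner ℂ (A.toEuclideanLin x) x := by
    rw [← inner_conj_symm, EuclideanSpace.inner_eq_star_dotProduct, dotProduct_comm]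
    exact star_nonneg_iff.mpr (h x.ofLp)
  obtain ⟨hre, him⟩ := Complex.nonneg_iff.mp hx
  exact ⟨Complex.ext (by simp) (by simpa using him), hre⟩

/-- A linear map from a C⋆-algebra to complex matrices which is positive is continuous. -/
theorem continuous_of_forall_star_mul_self_posSemidef {n : Type*} [Fintype n]
    (φ : N →ₗ[ℂ] Matrix n n ℂ) (h : ∀ y : N, (φ (star y * y)).PosSemidef) :
    Continuous φ := by
  classical
  let _ : CStarAlgebra N := {}
  let _ : PartialOrder N := CStarAlgebra.spectralOrder N
  have : StarOrderedRing N := CStarAlgebra.spectralOrderedRing N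
  open scoped Matrix.Norms.L2Operator MatrixOrder in
  let f : N →ₚ[ℂ] Matrix n n ℂ := .mk₀ φ fun x hx ↦ by
    obtain ⟨y, rfl⟩ := CStarAlgebra.nonneg_iff_eq_star_mul_self.mp hx
    exact (h y).nonneg
  exact map_continuous f

/-- The entrywise pairing of two positive semidefinite matrices is nonnegative. -/
theorem sum_mul_nonneg_of_posSemidef {n : Type*} [Fintype n] {A B : Matrix n n ℂ}
    (hA : A.PosSemidef) (hB : B.PosSemidef) : 0 ≤ ∑ i, ∑ j, A i j * B i j := by
  simpa [dotProduct, mulVec] using (hA.hadamard hB).dotProduct_mulVec_nonneg 1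

/-- for a linear map `φ : N → M_d(ℂ)`, the functional
`φ̂(∑ aᵢ ⊗ bᵢ) = Tr(∑ aᵢᵀ φ(bᵢ))` on `M_d(ℂ) ⊗ N` (which in matrix coordinates is
`φ̂([bᵢⱼ]) = ∑ᵢⱼ φ(bᵢⱼ)ᵢⱼ`) is nonnegative on all separable elements iff `φ` is a
positive map. -/
theorem stmt13 (d : ℕ) (φ : N →ₗ[ℂ] Matrix (Fin d) (Fin d) ℂ) :
    (∀ M ∈ SepN (N := N) d, 0 ≤ ∑ i : Fin d, ∑ j : Fin d, φ (M i j) i j) ↔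
    (∀ b : N, (∃ y : N, b = star y * y) → (φ b).PosSemidef) := by
  constructor
  · intro h b hb
    refine posSemidef_of_forall_dotProduct_mulVec_nonneg fun x ↦ ?_
    have hx := h (fun i j ↦ vecMulVec (star x) x i j • b) <| subset_closure
      ⟨1, fun _ ↦ vecMulVec (star x) x, fun _ ↦ b,
        fun _ ↦ posSemidef_vecMulVec_star_self x, fun _ ↦ hb, by rw [Fin.sum_univ_one]⟩
    simpa [dotProduct, mulVec, vecMulVec_apply, Finset.mul_sum, mul_assoc, mul_comm,
      mul_left_comm] using hx
  · intro h M hM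
    have hφ : Continuous φ :=
      continuous_of_forall_star_mul_self_posSemidef φ fun y ↦ h _ ⟨y, rfl⟩
    have hclosed : IsClosed {M : Matrix (Fin d) (Fin d) N | 0 ≤ ∑ i, ∑ j, φ (M i j) i j} := by
      refine isClosed_Ici.preimage (f := fun M : Matrix (Fin d) (Fin d) N ↦
        ∑ i, ∑ j, φ (M i j) i j) ?_
      exact continuous_finsetSum _ fun i _ ↦ continuous_finsetSum _ fun j _ ↦
        (hφ.comp (continuous_id.matrix_elem i j)).matrix_elem i j
    refine closure_minimal ?_ hclosed hM
    rintro _ ⟨L, P, Q, hP, hQ, rfl⟩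
    have key : ∑ i, ∑ j, φ (∑ t, P t i j • Q t) i j = ∑ t, ∑ i, ∑ j, P t i j * φ (Q t) i j := by
      simp only [map_sum, map_smul, Matrix.sum_apply, Matrix.smul_apply, smul_eq_mul]
      exact (Finset.sum_congr rfl fun i _ ↦ Finset.sum_comm).trans Finset.sum_comm
    have entry (i j : Fin d) : (∑ t, Matrix.of fun i j ↦ P t i j • Q t) i j = ∑ t, P t i j • Q t :=
      Matrix.sum_apply ..
    change 0 ≤ ∑ i, ∑ j, φ ((∑ t, Matrix.of fun i j ↦ P t i j • Q t) i j) i j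
    simp only [entry, key]
    exact Finset.sum_nonneg fun t _ ↦ sum_mul_nonneg_of_posSemidef (hP t) (h _ (hQ t))
end
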